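/- For any y, w̃ ∈ ℝ^d, the random vector g defined in the context satisfies E[ ‖g‖² ] ≤ 4 L̂ ( P(y) − P(w*) ) + 4 L̂ ( P(w̃) − P(w*) ). -/

import Mathlib

open scoped RealInnerProductSpace BigOperators

lemma aux_first_order {E : Type*} [NormedAddCommGroup E] [InnerProductSpace ℝ E] [CompleteSpace E]
    (f : E → ℝ) (g x z : E) (hg : HasGradientAt f g x) (hc : ConvexOn ℝ Set.univ f) :
    f x + ⟪g, z - x⟫ ≤ f z := by
  have hline : HasDerivAt (fun t : ℝ => x + t • (z - x)) (z - x) 0 := by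
    simpa using ((hasDerivAt_id (0 : ℝ)).smul_const (z - x)).const_add x
  have hg' : HasFDerivAt f (InnerProductSpace.toDual ℝ E g) (x + (0 : ℝ) • (z - x)) := by
    simpa using hg.hasFDerivAt
  have hd : HasDerivAt (fun t : ℝ => f (x + t • (z - x))) ⟪g, z - x⟫ 0 := by
    have h := hg'.comp_hasDerivAt (0 : ℝ) hline
    rw [InnerProductSpace.toDual_apply_apply] at h
    exact h
  have hcl : ConvexOn ℝ Set.univ (fun t : ℝ => f (x + t • (z - x))) := by
    refine ⟨convex_univ, fun a _ b _ s t hs ht hst => ?_⟩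
    have := hc.2 (Set.mem_univ (x + a • (z - x))) (Set.mem_univ (x + b • (z - x))) hs ht hst
    refine le_trans (le_of_eq ?_) this
    obtain rfl : s = 1 - t := by linarith
    refine congrArg f ?_
    simp only [smul_eq_mul]
    module
  have := hcl.le_slope_of_hasDerivAt (Set.mem_univ 0) (Set.mem_univ 1) one_pos hd
  simp [slope_def_field] at this
  linarith

lemma aux_coord {d : ℕ} (f : EuclideanSpace ℝ (Fin d) → ℝ)
    (f' : EuclideanSpace ℝ (Fin d) → EuclideanSpace ℝ (Fin d))
    (hg : ∀ x, HasGradientAt f (f' x) x) (hc : ConvexOn ℝ Set.univ f) (j : Fin d) (L : ℝ)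
    (hL : 0 < L)
    (hs : ∀ (x : EuclideanSpace ℝ (Fin d)) (t : ℝ),
      f (x + t • EuclideanSpace.single j (1 : ℝ)) ≤ f x + t * (f' x) j + L / 2 * t ^ 2)
    (x y : EuclideanSpace ℝ (Fin d)) :
    ((f' y) j - (f' x) j) ^ 2 / L ≤ 2 * (f y - f x - ⟪f' x, y - x⟫) := by
  set A := (f' y) j - (f' x) j with hA
  have h1 := hs y (-(A / L))
  have h2 := aux_first_order f (f' x) x (y + (-(A / L)) • EuclideanSpace.single j (1 : ℝ)) (hg x) hc
  have h3 : ⟪f' x, y + (-(A / L)) • EuclideanSpace.single j (1 : ℝ) - x⟫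
      = ⟪f' x, y - x⟫ - A / L * (f' x) j := by
    rw [show y + (-(A / L)) • EuclideanSpace.single j (1 : ℝ) - x
      = (y - x) + (-(A / L)) • EuclideanSpace.single j (1 : ℝ) by abel]
    rw [inner_add_right, inner_smul_right, EuclideanSpace.inner_single_right]
    simp
    ring
  rw [h3] at h2
  have h4 : A / L * (f' y) j - A / L * (f' x) j = A ^ 2 / L := by rw [hA]; ring
  have h5 : L / 2 * (-(A / L)) ^ 2 = A ^ 2 / L / 2 := by field_simp
  rw [h5] at h1
  linarith

lemma aux_var {ι : Type*} [Fintype ι] (q a b : ι → ℝ) (m : ℝ) (hq : ∀ i, 0 ≤ q i)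
    (hq1 : ∑ i, q i = 1) (hm : ∑ i, q i * b i = m) :
    ∑ i, q i * (m + (a i - b i)) ^ 2 ≤ ∑ i, (2 * (q i * a i ^ 2) + 2 * (q i * b i ^ 2)) := by
  have h : ∑ i, q i * (m + (a i - b i)) ^ 2 ≤
      ∑ i, ((2 * (q i * a i ^ 2) + 2 * (q i * b i ^ 2)) - 4 * m * (q i * b i)
        + 2 * m ^ 2 * q i) := by
    refine Finset.sum_le_sum fun i _ => ?_
    nlinarith [mul_nonneg (hq i) (sq_nonneg (a i + (b i - m)))]
  rw [Finset.sum_add_distrib, Finset.sum_sub_distrib, ← Finset.mul_sum, ← Finset.mul_sum, hm,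
    hq1] at h
  nlinarith [sq_nonneg m]

/-- **Bound on the second moment of the S2CD stochastic gradient estimate**
(Lemma 3.1 of Konečný's thesis).  With coordinate-wise smoothness constants `Lmat i j`,
`ω_i = |{j : L_{ij} > 0}|`, `v_j = ∑_i ω_i L_{ij}`, `p_j = v_j / ∑_{j'} v_{j'}`,
`q_{ij} = ω_i L_{ij} / v_j` and `L̂ = (1/n) ∑_j v_j`, the random vector
`g = p_j⁻¹ (∇_j P(w̃) + (1/(n q_{ij}))(∇_j f_i(y) − ∇_j f_i(w̃))) e_j` (sample `j` with
probability `p_j`, then `i` with probability `q_{ij}`) satisfies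
`E ‖g‖² ≤ 4 L̂ (P(y) − P(w*)) + 4 L̂ (P(w̃) − P(w*))`. -/
theorem s2cd_variance_bound
    (d n : ℕ) (hn : 0 < n) (hd : 0 < d)
    (f : Fin n → EuclideanSpace ℝ (Fin d) → ℝ)
    (f' : Fin n → EuclideanSpace ℝ (Fin d) → EuclideanSpace ℝ (Fin d))
    (hgrad : ∀ i x, HasGradientAt (f i) (f' i x) x)
    (hconvex : ∀ i, ConvexOn ℝ Set.univ (f i))
    (Lmat : Fin n → Fin d → ℝ) (hLnn : ∀ i j, 0 ≤ Lmat i j)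
    (hLsmooth : ∀ (i : Fin n) (j : Fin d) (x : EuclideanSpace ℝ (Fin d)) (t : ℝ),
      f i (x + t • EuclideanSpace.single j (1 : ℝ))
        ≤ f i x + t * (f' i x) j + Lmat i j / 2 * t ^ 2)
    (hLzero : ∀ i j, Lmat i j = 0 → ∀ x y, (f' i x) j = (f' i y) j)
    (hcol : ∀ j, ∃ i, 0 < Lmat i j)
    (P : EuclideanSpace ℝ (Fin d) → ℝ)
    (hP : ∀ w, P w = (1 / (n : ℝ)) * ∑ i, f i w)
    (P' : EuclideanSpace ℝ (Fin d) → EuclideanSpace ℝ (Fin d))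
    (hP' : ∀ w, P' w = (1 / (n : ℝ)) • ∑ i, f' i w)
    (wstar : EuclideanSpace ℝ (Fin d)) (hmin : ∀ w, P wstar ≤ P w)
    (ωc : Fin n → ℝ) (hωc : ∀ i, ωc i = ({j | 0 < Lmat i j}.ncard : ℝ))
    (v : Fin d → ℝ) (hv : ∀ j, v j = ∑ i, ωc i * Lmat i j)
    (p : Fin d → ℝ) (hp : ∀ j, p j = v j / ∑ j', v j')
    (q : Fin n → Fin d → ℝ) (hq : ∀ i j, q i j = ωc i * Lmat i j / v j)
    (Lhat : ℝ) (hLhat : Lhat = (1 / (n : ℝ)) * ∑ j, v j)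
    (y wt : EuclideanSpace ℝ (Fin d)) :
    ∑ j, ∑ i, (p j * q i j) *
        ‖((p j)⁻¹ * ((P' wt) j + 1 / ((n : ℝ) * q i j) * ((f' i y) j - (f' i wt) j))) •
            EuclideanSpace.single j (1 : ℝ)‖ ^ 2
      ≤ 4 * Lhat * (P y - P wstar) + 4 * Lhat * (P wt - P wstar) := by
  have hn' : (0 : ℝ) < n := by exact_mod_cast hn
  have hω : ∀ i j, 0 < Lmat i j → 0 < ωc i := by
    intro i j h
    rw [hωc]
    exact_mod_cast (Set.ncard_pos (Set.toFinite _)).2 ⟨j, h⟩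
  have hω0 : ∀ i, 0 ≤ ωc i := fun i => by rw [hωc]; positivity
  have hvpos : ∀ j, 0 < v j := by
    intro j
    obtain ⟨i, hi⟩ := hcol j
    rw [hv]
    exact Finset.sum_pos' (fun i _ => mul_nonneg (hω0 i) (hLnn i j))
      ⟨i, Finset.mem_univ _, mul_pos (hω i j hi) hi⟩
  have hS : 0 < ∑ j, v j :=
    Finset.sum_pos (fun j _ => hvpos j) ⟨⟨0, hd⟩, Finset.mem_univ _⟩
  have hLh : 0 < Lhat := by rw [hLhat]; positivity
  have hSL : ∑ j, v j = n * Lhat := by rw [hLhat]; field_simp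
  have hppos : ∀ j, 0 < p j := fun j => by rw [hp]; exact div_pos (hvpos j) hS
  have hqnn : ∀ i j, 0 ≤ q i j := fun i j => by
    rw [hq]; exact div_nonneg (mul_nonneg (hω0 i) (hLnn i j)) (hvpos j).le
  have hqsum : ∀ j, ∑ i, q i j = 1 := by
    intro j
    simp_rw [hq]
    rw [← Finset.sum_div, ← hv, div_self (hvpos j).ne']
  have hP0 : P' wstar = 0 := by
    have hPg : HasFDerivAt P (InnerProductSpace.toDual ℝ _ (P' wstar)) wstar := by
      have hPe : P = fun w => (1 / (n : ℝ)) * ∑ i, f i w := funext hP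
      rw [hPe, hP', map_smul, map_sum]
      exact (HasFDerivAt.fun_sum fun i _ => (hgrad i wstar).hasFDerivAt).const_mul _
    have hloc : IsLocalMin P wstar := Filter.Eventually.of_forall hmin
    have := hloc.hasFDerivAt_eq_zero hPg
    simpa using this
  have hPsum : ∀ w j, (P' w) j = (1 / (n : ℝ)) * ∑ i, (f' i w) j := by
    intro w j; rw [hP']; simp
  have key : ∀ z : EuclideanSpace ℝ (Fin d),
      ∑ j, ∑ i, (p j)⁻¹ * (q i j * (1 / ((n : ℝ) * q i j) * ((f' i z) j - (f' i wstar) j)) ^ 2)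
        ≤ 2 * Lhat * (P z - P wstar) := by
    intro z
    have hnn : ∀ i, 0 ≤ f i z - f i wstar - ⟪f' i wstar, z - wstar⟫ := fun i => by
      have := aux_first_order (f i) _ wstar z (hgrad i wstar) (hconvex i)
      linarith
    rw [Finset.sum_comm]
    have hi : ∀ i, ∑ j, (p j)⁻¹ * (q i j *
        (1 / ((n : ℝ) * q i j) * ((f' i z) j - (f' i wstar) j)) ^ 2)
        ≤ Lhat / n * (2 * (f i z - f i wstar - ⟪f' i wstar, z - wstar⟫)) := by
      intro i
      set H := f i z - f i wstar - ⟪f' i wstar, z - wstar⟫ with hH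
      have ht : ∀ j, (p j)⁻¹ * (q i j *
          (1 / ((n : ℝ) * q i j) * ((f' i z) j - (f' i wstar) j)) ^ 2)
          ≤ if 0 < Lmat i j then Lhat / n * (2 * H) / ωc i else 0 := by
        intro j
        split_ifs with h
        · have hk := aux_coord (f i) (f' i) (hgrad i) (hconvex i) j _ h (hLsmooth i j) wstar z
          rw [← hH] at hk
          have hw := hω i j h
          have hvj := hvpos j
          have e : (p j)⁻¹ * (q i j *
              (1 / ((n : ℝ) * q i j) * ((f' i z) j - (f' i wstar) j)) ^ 2)
              = Lhat / n * (((f' i z) j - (f' i wstar) j) ^ 2 / Lmat i j) / ωc i := by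
            rw [hp, hq, hSL]
            field_simp
          rw [e]
          gcongr
        · have h0 : Lmat i j = 0 := le_antisymm (not_lt.1 h) (hLnn i j)
          rw [hq, h0]; simp
      refine (Finset.sum_le_sum fun j _ => ht j).trans ?_
      rw [← Finset.sum_filter, Finset.sum_const, nsmul_eq_mul]
      have hcard : ((Finset.univ.filter fun j => 0 < Lmat i j).card : ℝ) = ωc i := by
        rw [hωc, ← Set.ncard_coe_finset]; simp
      rw [hcard]
      rcases (hω0 i).eq_or_lt with h | h
      · rw [← h]; simp
        have := hnn i
        positivity
      · rw [mul_div_cancel₀ _ h.ne']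
    refine (Finset.sum_le_sum fun i _ => hi i).trans (le_of_eq ?_)
    rw [← Finset.mul_sum, ← Finset.mul_sum, Finset.sum_sub_distrib, Finset.sum_sub_distrib,
      ← sum_inner, hP z, hP wstar]
    have h0 : ∑ i, f' i wstar = 0 := by
      have := hP' wstar
      rw [hP0] at this
      rcases smul_eq_zero.1 this.symm with h | h
      · exact absurd h (by positivity)
      · exact h
    rw [h0, inner_zero_left]
    ring
  have hj : ∀ j, ∑ i, (p j * q i j) *
        ‖((p j)⁻¹ * ((P' wt) j + 1 / ((n : ℝ) * q i j) * ((f' i y) j - (f' i wt) j))) •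
            EuclideanSpace.single j (1 : ℝ)‖ ^ 2
      ≤ 2 * (∑ i, (p j)⁻¹ * (q i j * (1 / ((n : ℝ) * q i j) *
          ((f' i y) j - (f' i wstar) j)) ^ 2))
        + 2 * (∑ i, (p j)⁻¹ * (q i j * (1 / ((n : ℝ) * q i j) *
          ((f' i wt) j - (f' i wstar) j)) ^ 2)) := by
    intro j
    have hm : ∑ i, q i j * (1 / ((n : ℝ) * q i j) * ((f' i wt) j - (f' i wstar) j))
        = (P' wt) j := by
      have e1 : (P' wt) j = (P' wt) j - (P' wstar) j := by rw [hP0]; simp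
      rw [e1, hPsum, hPsum, ← mul_sub, ← Finset.sum_sub_distrib, Finset.mul_sum]
      refine Finset.sum_congr rfl fun i _ => ?_
      rcases (hLnn i j).eq_or_lt with h | h
      · rw [hLzero i j h.symm wt wstar]; simp
      · have hqp : 0 < q i j := by
          rw [hq]; exact div_pos (mul_pos (hω i j h) h) (hvpos j)
        field_simp
    have hvar := aux_var (fun i => q i j)
      (fun i => 1 / ((n : ℝ) * q i j) * ((f' i y) j - (f' i wstar) j))
      (fun i => 1 / ((n : ℝ) * q i j) * ((f' i wt) j - (f' i wstar) j))
      _ (fun i => hqnn i j) (hqsum j) hm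
    have hvar2 := mul_le_mul_of_nonneg_left hvar (inv_nonneg.2 (hppos j).le)
    rw [Finset.sum_add_distrib, ← Finset.mul_sum, ← Finset.mul_sum] at hvar2
    rw [← Finset.mul_sum, ← Finset.mul_sum]
    refine le_trans (le_of_eq ?_) (hvar2.trans (le_of_eq (by ring)))
    rw [Finset.mul_sum]
    refine Finset.sum_congr rfl fun i _ => ?_
    have hpj := hppos j
    rw [norm_smul, mul_pow, Real.norm_eq_abs, sq_abs, EuclideanSpace.norm_single, ← mul_sub]
    have e3 : (f' i y) j - (f' i wstar) j - ((f' i wt) j - (f' i wstar) j)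
      = (f' i y) j - (f' i wt) j := by ring
    rw [e3, mul_pow]
    have e4 : p j * (p j)⁻¹ ^ 2 = (p j)⁻¹ := by field_simp
    rw [norm_one, one_pow, mul_one]
    nth_rewrite 2 [← e4]
    ring
  refine (Finset.sum_le_sum fun j _ => hj j).trans ?_
  rw [Finset.sum_add_distrib, ← Finset.mul_sum, ← Finset.mul_sum]
  linarith [key y, key wt]
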